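/- (Lemma 2.8) If A ≤ B in LG∅ (respectively LG_I), then the presentation A, B⊥ ⊢ is derivable in the LG∅ (respectively LG_I) one-sided sequent calculus. -/

import Mathlib

/-- Unpolarized formulas of LG/CNL.  `ldiv B A` denotes `B\A`, `lsub B A` denotes `B⦸A`,
`rdiv A B` denotes `A/B`, `rsub A B` denotes `A⊘B`. -/
inductive Fm : Type
  | pos : Nat → Fm                -- positive atom p
  | neg : Nat → Fm                -- negative atom p̄
  | tens : Fm → Fm → Fm           -- A ⊗ B
  | par : Fm → Fm → Fm            -- A ⊕ B
  | rdiv : Fm → Fm → Fm           -- A / B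
  | ldiv : Fm → Fm → Fm           -- B \ A  (ldiv B A)
  | rsub : Fm → Fm → Fm           -- A ⊘ B
  | lsub : Fm → Fm → Fm           -- B ⦸ A  (lsub B A)
  | conj : Fm → Fm → Fm           -- A ∧ B
  | disj : Fm → Fm → Fm           -- A ∨ B

/-- Linear negation. -/
def Fm.dual : Fm → Fm
  | .pos n => .neg n
  | .neg n => .pos n
  | .tens A B => .par B.dual A.dual        -- (A⊗B)⊥ = B⊥⊕A⊥
  | .par A B => .tens B.dual A.dual        -- (A⊕B)⊥ = B⊥⊗A⊥
  | .rdiv A B => .lsub B.dual A.dual       -- (A/B)⊥ = B⊥⦸A⊥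
  | .lsub B A => .rdiv A.dual B.dual       -- (B⦸A)⊥ = A⊥/B⊥
  | .ldiv B A => .rsub A.dual B.dual       -- (B\A)⊥ = A⊥⊘B⊥
  | .rsub A B => .ldiv B.dual A.dual       -- (A⊘B)⊥ = B⊥\A⊥
  | .conj A B => .disj B.dual A.dual       -- (A∧B)⊥ = B⊥∨A⊥
  | .disj A B => .conj B.dual A.dual       -- (A∨B)⊥ = B⊥∧A⊥
/-- Algebraic derivability `Le I A B` (`A ≤ B`).  The Boolean index `I` tells whether the
Grishin linear distributivity rules of LG_I are available: `Le false` is LG∅, `Le true` is LG_I. -/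
inductive Le : Bool → Fm → Fm → Prop
  | refl (I : Bool) (A : Fm) : Le I A A
  | trans {I A B C} : Le I A B → Le I B C → Le I A C
  -- residuation: A⊗B ≤ C iff A ≤ C/B iff B ≤ A\C
  | res_div {I A B C} : Le I (.tens A B) C → Le I A (.rdiv C B)
  | res_div' {I A B C} : Le I A (.rdiv C B) → Le I (.tens A B) C
  | res_ldiv {I A B C} : Le I (.tens A B) C → Le I B (.ldiv A C)
  | res_ldiv' {I A B C} : Le I B (.ldiv A C) → Le I (.tens A B) C
  -- coresiduation: C ≤ A⊕B iff A⦸C ≤ B iff C⊘B ≤ A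
  | cores_lsub {I A B C} : Le I C (.par A B) → Le I (.lsub A C) B
  | cores_lsub' {I A B C} : Le I (.lsub A C) B → Le I C (.par A B)
  | cores_rsub {I A B C} : Le I C (.par A B) → Le I (.rsub C B) A
  | cores_rsub' {I A B C} : Le I (.rsub C B) A → Le I C (.par A B)
  -- meets: A ≤ B∧C iff A ≤ B and A ≤ C
  | meet_intro {I A B C} : Le I A B → Le I A C → Le I A (.conj B C)
  | meet_left {I A B C} : Le I A (.conj B C) → Le I A B
  | meet_right {I A B C} : Le I A (.conj B C) → Le I A C
  -- joins: A∨B ≤ C iff A ≤ C and B ≤ C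
  | join_intro {I A B C} : Le I A C → Le I B C → Le I (.disj A B) C
  | join_left {I A B C} : Le I (.disj A B) C → Le I A C
  | join_right {I A B C} : Le I (.disj A B) C → Le I B C
  -- Grishin linear distributivity (only in LG_I)
  | gr1 {A B C D} : Le true (.rsub A B) (.ldiv C D) → Le true (.tens C A) (.par D B)
  | gr2 {A B C D} : Le true (.lsub A B) (.rdiv C D) → Le true (.tens B D) (.par A C)
  | gr3 {A B C D} : Le true (.lsub A B) (.ldiv C D) → Le true (.tens C B) (.par A D)
  | gr4 {A B C D} : Le true (.rsub A B) (.rdiv C D) → Le true (.tens A D) (.par C B)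
/-- Structures: Γ ::= A | Γ·⊗·Δ | Γ·⊘·Δ | Δ·⦸·Γ.
`slsub Δ Γ` denotes `Δ·⦸·Γ`, `srsub Γ Δ` denotes `Γ·⊘·Δ`. -/
inductive Str : Type
  | fm : Fm → Str
  | stens : Str → Str → Str
  | srsub : Str → Str → Str
  | slsub : Str → Str → Str

mutual
/-- The positive formula interpretation Γ⁺ of a structure. -/
def Str.posF : Str → Fm
  | .fm A => A
  | .stens Γ Δ => .tens Γ.posF Δ.posF
  | .srsub Γ Δ => .rsub Γ.posF Δ.negF
  | .slsub Δ Γ => .lsub Δ.negF Γ.posF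
/-- The negative formula interpretation Γ⁻ of a structure. -/
def Str.negF : Str → Fm
  | .fm A => A.dual
  | .stens Γ Δ => .par Δ.negF Γ.negF
  | .srsub Γ Δ => .ldiv Δ.posF Γ.negF
  | .slsub Δ Γ => .rdiv Γ.negF Δ.posF
end

/-- One-sided sequent derivability `DSeq g c Γ Δ` of the presentation `Γ,Δ ⊢`.
The flag `g` enables the Grishin (linear distributivity) structural rules of LG_I,
the flag `c` enables the CNL structural rules.  Thus `DSeq false false` is LG∅,
`DSeq true false` is LG_I, and `DSeq false true` is CNL. -/
inductive DSeq : Bool → Bool → Str → Str → Prop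
  | ax {g c A} : DSeq g c (.fm A) (.fm A.dual)
  | cut {g c Γ Δ A} : DSeq g c Δ (.fm A) → DSeq g c Γ (.fm A.dual) → DSeq g c Γ Δ
  | sym {g c Γ Δ} : DSeq g c Γ Δ → DSeq g c Δ Γ
  | dp1 {g c Γ Δ Θ} : DSeq g c (.stens Γ Δ) Θ → DSeq g c Γ (.slsub Δ Θ)
  | dp1' {g c Γ Δ Θ} : DSeq g c Γ (.slsub Δ Θ) → DSeq g c (.stens Γ Δ) Θ
  | dp2 {g c Γ Δ Θ} : DSeq g c Γ (.stens Δ Θ) → DSeq g c (.srsub Γ Δ) Θ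
  | dp2' {g c Γ Δ Θ} : DSeq g c (.srsub Γ Δ) Θ → DSeq g c Γ (.stens Δ Θ)
  | tensL {g c Γ A B} : DSeq g c Γ (.stens (.fm A) (.fm B)) → DSeq g c Γ (.fm (.tens A B))
  | lsubL {g c Γ A B} : DSeq g c Γ (.slsub (.fm B.dual) (.fm A)) → DSeq g c Γ (.fm (.lsub B A))
  | rsubL {g c Γ A B} : DSeq g c Γ (.srsub (.fm A) (.fm B.dual)) → DSeq g c Γ (.fm (.rsub A B))
  | parL {g c Γ Δ A B} : DSeq g c Γ (.fm A) → DSeq g c Δ (.fm B) →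
      DSeq g c (.stens Δ Γ) (.fm (.par A B))
  | rdivL {g c Γ Δ A B} : DSeq g c Δ (.fm B.dual) → DSeq g c Γ (.fm A) →
      DSeq g c (.slsub Δ Γ) (.fm (.rdiv A B))
  | ldivL {g c Γ Δ A B} : DSeq g c Δ (.fm B.dual) → DSeq g c Γ (.fm A) →
      DSeq g c (.srsub Γ Δ) (.fm (.ldiv B A))
  | conjL1 {g c Γ A B} : DSeq g c Γ (.fm A) → DSeq g c Γ (.fm (.conj A B))
  | conjL2 {g c Γ A B} : DSeq g c Γ (.fm B) → DSeq g c Γ (.fm (.conj A B))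
  | disjL {g c Γ A B} : DSeq g c Γ (.fm A) → DSeq g c Γ (.fm B) → DSeq g c Γ (.fm (.disj A B))
  -- Grishin structural rules (LG_I)
  | gr1 {c Γ₁ Γ₂ Δ₁ Δ₂} : DSeq true c (.srsub Γ₂ Δ₂) (.srsub Δ₁ Γ₁) →
      DSeq true c (.stens Γ₁ Γ₂) (.stens Δ₂ Δ₁)
  | gr2 {c Γ₁ Γ₂ Δ₁ Δ₂} : DSeq true c (.slsub Δ₁ Γ₁) (.slsub Γ₂ Δ₂) →
      DSeq true c (.stens Γ₁ Γ₂) (.stens Δ₂ Δ₁)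
  | gr3 {c Γ₁ Γ₂ Δ₁ Δ₂} : DSeq true c (.srsub Δ₂ Γ₁) (.slsub Δ₁ Γ₂) →
      DSeq true c (.stens Γ₁ Γ₂) (.stens Δ₂ Δ₁)
  -- CNL structural rules
  | cnl1 {g Γ Δ Θ} : DSeq g true Γ (.srsub Δ Θ) → DSeq g true Γ (.stens Δ Θ)
  | cnl1' {g Γ Δ Θ} : DSeq g true Γ (.stens Δ Θ) → DSeq g true Γ (.srsub Δ Θ)
  | cnl2 {g Γ Δ Θ} : DSeq g true Γ (.slsub Δ Θ) → DSeq g true Γ (.stens Δ Θ)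
  | cnl2' {g Γ Δ Θ} : DSeq g true Γ (.stens Δ Θ) → DSeq g true Γ (.slsub Δ Θ)

theorem Fm.dual_dual' (A : Fm) : A.dual.dual = A := by
  induction A <;> simp_all [Fm.dual]

theorem inv_tens {g c Γ A B} (h : DSeq g c Γ (.fm (.tens A B))) :
    DSeq g c Γ (.stens (.fm A) (.fm B)) :=
  .sym (.cut h (.parL .ax .ax))

theorem inv_lsub {g c Γ A B} (h : DSeq g c Γ (.fm (.lsub B A))) :
    DSeq g c Γ (.slsub (.fm B.dual) (.fm A)) :=
  .sym (.cut h (.rdivL .ax .ax))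

theorem inv_rsub {g c Γ A B} (h : DSeq g c Γ (.fm (.rsub A B))) :
    DSeq g c Γ (.srsub (.fm A) (.fm B.dual)) :=
  .sym (.cut h (.ldivL .ax .ax))

theorem inv_disj1 {g c Γ A B} (h : DSeq g c Γ (.fm (.disj A B))) : DSeq g c Γ (.fm A) :=
  .sym (.cut h (.conjL2 .ax))

theorem inv_disj2 {g c Γ A B} (h : DSeq g c Γ (.fm (.disj A B))) : DSeq g c Γ (.fm B) :=
  .sym (.cut h (.conjL1 .ax))

theorem lsubL' {g c Γ A B} (h : DSeq g c Γ (.slsub (.fm B) (.fm A))) :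
    DSeq g c Γ (.fm (.lsub B.dual A)) := .lsubL (by rwa [Fm.dual_dual'])

theorem rsubL' {g c Γ A B} (h : DSeq g c Γ (.srsub (.fm A) (.fm B))) :
    DSeq g c Γ (.fm (.rsub A B.dual)) := .rsubL (by rwa [Fm.dual_dual'])

theorem inv_lsub' {g c Γ A B} (h : DSeq g c Γ (.fm (.lsub B.dual A))) :
    DSeq g c Γ (.slsub (.fm B) (.fm A)) := by
  have := inv_lsub h
  rwa [Fm.dual_dual'] at this

theorem inv_rsub' {g c Γ A B} (h : DSeq g c Γ (.fm (.rsub A B.dual))) :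
    DSeq g c Γ (.srsub (.fm A) (.fm B)) := by
  have := inv_rsub h
  rwa [Fm.dual_dual'] at this

/-- Lemma 2.8: if A ≤ B in LG∅ (`g = false`) respectively LG_I (`g = true`),
then the presentation `A, B⊥ ⊢` is derivable in the corresponding one-sided sequent calculus. -/
theorem alg_to_seq (g : Bool) (A B : Fm) (h : Le g A B) :
    DSeq g false (.fm A) (.fm B.dual) := by
  induction h with
  | refl => exact .ax
  | trans _ _ h1 h2 => exact .cut (.sym h2) h1
  | res_div _ h => exact lsubL' (.dp1 (.sym (inv_tens (.sym h))))
  | res_div' _ h => exact .sym (.tensL (.sym (.dp1' (inv_lsub' h))))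
  | res_ldiv _ h => exact rsubL' (.sym (.dp2 (inv_tens (.sym h))))
  | res_ldiv' _ h => exact .sym (.tensL (.dp2' (.sym (inv_rsub' h))))
  | cores_lsub _ h => exact .sym (.lsubL (.dp1 (.sym (inv_tens h))))
  | cores_lsub' _ h => exact .tensL (.sym (.dp1' (inv_lsub (.sym h))))
  | cores_rsub _ h => exact .sym (.rsubL (.sym (.dp2 (inv_tens h))))
  | cores_rsub' _ h => exact .tensL (.dp2' (.sym (inv_rsub (.sym h))))
  | meet_intro _ _ h1 h2 => exact .disjL h2 h1
  | meet_left _ h => exact inv_disj2 h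
  | meet_right _ h => exact inv_disj1 h
  | join_intro _ _ h1 h2 => exact .sym (.disjL (.sym h1) (.sym h2))
  | join_left _ h => exact .sym (inv_disj1 (.sym h))
  | join_right _ h => exact .sym (inv_disj2 (.sym h))
  | gr1 _ h =>
    exact .tensL (.sym (.tensL (.sym (.gr1 (.sym (inv_rsub (.sym (inv_rsub' h))))))))
  | gr2 _ h =>
    exact .tensL (.sym (.tensL (.sym (.gr2 (.sym (inv_lsub (.sym (inv_lsub' h))))))))
  | gr3 _ h =>
    exact .tensL (.sym (.tensL (.sym (.gr3 (inv_lsub (.sym (inv_rsub' h)))))))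
  | gr4 _ h =>
    exact .tensL (.sym (.tensL (.gr3 (.sym (inv_rsub (.sym (inv_lsub' h)))))))
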